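/- For every integer n ≥ 1, Σ_{σ ∈ Q_n^2} q^{cyc(σ)} = q·(q+2)·(q+4)···(q+2n−2) as an identity of polynomials in q. -/

import Mathlib

open scoped Classical
noncomputable section

/-- The multiset `{1,1,2,2,…,n,n}` as a list. -/
def baseList (n : ℕ) : List ℕ := (List.range n).flatMap (fun i => [i + 1, i + 1])

/-- A word is Stirling if whenever the same value occurs at positions `i < k`,
every entry strictly between them is greater than that value. -/
def IsStirlingWord (l : List ℕ) : Prop :=
  ∀ i j k : Fin l.length, i < j → j < k → l.get i = l.get k → l.get i < l.get j

/-- The set `Q_n` of Stirling permutations of order `n`:  rearrangements of the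
multiset `{1,1,2,2,…,n,n}` in which all entries between the two occurrences of any
value exceed that value. -/
def stirlingPerms (n : ℕ) : Finset (List ℕ) :=
  ((baseList n).permutations.toFinset).filter IsStirlingWord

/-- Number of descents of `σ ∈ Q_n`: indices `i ∈ {1,…,2n}` (here 0-based) with
`σ_i > σ_{i+1}`, with the convention `σ_{2n+1} = 0`. -/
def desList (l : List ℕ) : ℕ :=
  ((Finset.range l.length).filter (fun i => l.getD (i + 1) 0 < l.getD i 0)).card

/-- The second-order Eulerian polynomial `C_n(x) = ∑_{σ ∈ Q_n} x^{des σ}`. -/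
def Cpoly (n : ℕ) : Polynomial ℚ :=
  ∑ σ ∈ stirlingPerms n, Polynomial.X ^ desList σ

/-- A list of cycles is a valid standard cycle form of a Stirling permutation of the
second kind of order `n` if:  the cycles are disjoint and together use each of
`1,1,2,2,…,n,n` exactly once; both copies of any value lie in the same cycle; each
cycle starts with (one of) its smallest entries; the cycles are listed in increasing
order of their smallest (first) entries; and the word of each cycle reduces to a
Stirling permutation. -/
def IsStirling2 (n : ℕ) (c : List (List ℕ)) : Prop :=
  c.flatten.Perm (baseList n) ∧
  (∀ w ∈ c, w ≠ [] ∧ (∀ v ∈ w, w.count v = 2) ∧ (∀ v ∈ w, w.headI ≤ v) ∧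
      IsStirlingWord w) ∧
  c.Chain' (fun w₁ w₂ => w₁.headI < w₂.headI)

/-- The set `Q_n²` of Stirling permutations of the second kind of order `n`,
each recorded as its standard cycle form (a list of cycles). -/
def stirling2 (n : ℕ) : Finset (List (List ℕ)) :=
  ((((baseList n).permutations.toFinset) ×ˢ (Finset.univ : Finset (Composition (2 * n)))).image
      (fun p => p.1.splitWrtComposition p.2)).filter (IsStirling2 n)

/-- `cyc(σ)`: the number of cycles. -/
def cyc (c : List (List ℕ)) : ℕ := c.length

/-- `cplat(σ)`: the number of cycle plateaus, i.e. entries `c_i` of a cycle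
`(c_1,…,c_{2k})` with `c_i = c_{i+1}`, `1 ≤ i < 2k`. -/
def cplat (c : List (List ℕ)) : ℕ :=
  (c.map (fun w => ((Finset.range w.length).filter
    (fun i => i + 1 < w.length ∧ w.getD i 0 = w.getD (i + 1) 0)).card)).sum

/-- `casc(σ)`: the number of cycle ascents, i.e. entries `c_i` of a cycle
`(c_1,…,c_{2k})` with `c_i < c_{i+1}`, `1 ≤ i < 2k`. -/
def casc (c : List (List ℕ)) : ℕ :=
  (c.map (fun w => ((Finset.range w.length).filter
    (fun i => i + 1 < w.length ∧ w.getD i 0 < w.getD (i + 1) 0)).card)).sum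

/-- `cap(σ)`: the number of cycle ascent plateaus, i.e. entries `c_i` of a cycle
`(c_1,…,c_{2k})` with `c_{i-1} < c_i = c_{i+1}`, `2 ≤ i ≤ 2k-1`. -/
def capSt (c : List (List ℕ)) : ℕ :=
  (c.map (fun w => ((Finset.range w.length).filter
    (fun i => 0 < i ∧ i + 1 < w.length ∧
      w.getD (i - 1) 0 < w.getD i 0 ∧ w.getD i 0 = w.getD (i + 1) 0)).card)).sum

/-- `fix(σ)`: the number of fixed points, i.e. values `k` with `(k,k)` a cycle of `σ`. -/
def fixSt (c : List (List ℕ)) : ℕ :=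
  ((Finset.range c.length).filter (fun i => ∃ k : ℕ, c.getD i [] = [k, k])).card

theorem isStirlingWord_iff_sublist (l : List ℕ) :
    IsStirlingWord l ↔ ∀ a x : ℕ, List.Sublist [a, x, a] l → a < x := by
  constructor
  · intro h a x hs
    obtain ⟨f, hf⟩ := List.sublist_iff_exists_fin_orderEmbedding_get_eq.1 hs
    have h0 := hf ⟨0, by simp⟩
    have h1 := hf ⟨1, by simp⟩
    have h2 := hf ⟨2, by simp⟩
    simp only [List.get_eq_getElem, List.getElem_cons_zero, List.getElem_cons_succ] at h0 h1 h2
    have := h (f ⟨0, by simp⟩) (f ⟨1, by simp⟩) (f ⟨2, by simp⟩)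
      (f.strictMono (by simp)) (f.strictMono (by simp))
      (by simp only [List.get_eq_getElem]; rw [← h0, ← h2])
    simp only [List.get_eq_getElem] at this
    rwa [← h0, ← h1] at this
  · intro h i j k hij hjk e
    refine h _ _ ?_
    have := List.map_getElem_sublist (l := l) (is := [i, j, k])
      (by simp [hij, hjk, hij.trans hjk])
    simpa [← List.get_eq_getElem, ← e] using this

theorem IsStirlingWord.sublist {l l' : List ℕ} (h : IsStirlingWord l)
    (hs : l'.Sublist l) : IsStirlingWord l' := by
  rw [isStirlingWord_iff_sublist] at h ⊢
  exact fun a x hx => h a x (hx.trans hs)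

theorem IsStirlingWord.insert_max {u v : List ℕ} {m : ℕ} (h : IsStirlingWord (u ++ v))
    (hm : ∀ x ∈ u ++ v, x < m) : IsStirlingWord (u ++ m :: m :: v) := by
  rw [isStirlingWord_iff_sublist] at h ⊢
  intro a x hs
  have hmu : m ∉ u := fun hx => lt_irrefl _ (hm m (by simp [hx]))
  have hmv : m ∉ v := fun hx => lt_irrefl _ (hm m (by simp [hx]))
  by_cases ham : a = m
  · subst ham
    exfalso
    obtain ⟨l₁, l₂, e, h₁, h₂⟩ := List.sublist_append_iff.1 hs
    rcases l₁ with _ | ⟨b, l₁⟩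
    · simp only [List.nil_append] at e
      subst e
      have h₃ : List.Sublist [x, a] (a :: v) := by
        simpa using h₂
      have h₄ : List.Sublist [a] v := by
        rcases List.sublist_cons_iff.1 h₃ with h | ⟨r, hr, h⟩
        · exact (List.sublist_cons_self x [a]).trans h
        · simp only [List.cons.injEq] at hr
          rwa [hr.2]
      exact hmv (by simpa using h₄)
    · simp only [List.cons_append, List.cons.injEq] at e
      exact hmu (h₁.subset (by simp [e.1]))
  · have ha : a ∈ u ++ v := by
      have := hs.subset (show a ∈ [a, x, a] by simp)
      simpa [ham] using this
    by_cases hxm : x = m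
    · exact hxm ▸ hm a ha
    · apply h a x
      have := hs.filter (fun y => decide (y ≠ m))
      have hu : u.filter (fun y => decide (y ≠ m)) = u :=
        List.filter_eq_self.2 fun y hy => by simpa using fun e : y = m => hmu (e ▸ hy)
      have hv : v.filter (fun y => decide (y ≠ m)) = v :=
        List.filter_eq_self.2 fun y hy => by simpa using fun e : y = m => hmv (e ▸ hy)
      have hmv' : (m :: m :: v).filter (fun y => decide (y ≠ m)) = v := by
        rw [List.filter_cons_of_neg (by simp), List.filter_cons_of_neg (by simp), hv]
      rw [List.filter_append, hu, hmv'] at this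
      simpa [List.filter_cons, ham, hxm] using this

theorem baseList_succ_perm (n : ℕ) :
    (baseList (n + 1)).Perm ((n + 1) :: (n + 1) :: baseList n) := by
  simp only [baseList, List.range_succ, List.flatMap_append, List.flatMap_cons,
    List.flatMap_nil, List.append_nil]
  exact List.perm_append_comm

theorem mem_baseList {n x : ℕ} : x ∈ baseList n ↔ 1 ≤ x ∧ x ≤ n := by
  simp only [baseList, List.mem_flatMap, List.mem_range, List.mem_cons, List.not_mem_nil,
    or_false, or_self]
  exact ⟨by rintro ⟨a, ha, rfl⟩; omega, fun h => ⟨x - 1, by omega, by omega⟩⟩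

theorem length_baseList (n : ℕ) : (baseList n).length = 2 * n := by
  simp [baseList, mul_comm]

theorem mem_stirling2 {n : ℕ} {c : List (List ℕ)} : c ∈ stirling2 n ↔ IsStirling2 n c := by
  simp only [stirling2, Finset.mem_filter, Finset.mem_image, Finset.mem_product,
    Finset.mem_univ, and_true, List.mem_toFinset, List.mem_permutations, Prod.exists,
    and_iff_right_iff_imp]
  intro h
  have key : ∀ k, c.flatten.length = k →
      ∃ p : Composition k, c.flatten.splitWrtComposition p = c := by
    rintro _ rfl
    refine ⟨⟨c.map List.length, ?_, by simp [List.length_flatten]⟩,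
      List.splitWrtComposition_flatten _ _ rfl⟩
    intro i hi
    obtain ⟨w, hw, rfl⟩ := List.mem_map.1 hi
    exact List.length_pos_iff.2 (h.2.1 w hw).1
  obtain ⟨p, hp⟩ := key (2 * n) (by rw [h.1.length_eq, length_baseList])
  exact ⟨_, p, h.1, hp⟩

theorem stirling2_zero : stirling2 0 = {[]} := by
  ext c
  rw [mem_stirling2, Finset.mem_singleton]
  constructor
  · intro h
    have h1 : c.flatten = [] := List.perm_nil.1 (by simpa [baseList] using h.1)
    rw [List.flatten_eq_nil_iff] at h1
    exact List.eq_nil_iff_forall_not_mem.2 fun w hw => (h.2.1 w hw).1 (h1 w hw)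
  · rintro rfl
    exact ⟨by simp [baseList], by simp, List.IsChain.nil⟩

/-- The words obtained from `w` by inserting `m m` immediately after one of its entries. -/
def insertAfter (m : ℕ) : List ℕ → List (List ℕ)
  | [] => []
  | a :: w => (a :: m :: m :: w) :: (insertAfter m w).map (a :: ·)

/-- The cycle lists obtained from `c` by inserting `m m` immediately after an entry of one of
its cycles. -/
def insertInCycle (m : ℕ) : List (List ℕ) → List (List (List ℕ))
  | [] => []
  | w :: c => (insertAfter m w).map (· :: c) ++ (insertInCycle m c).map (w :: ·)

/-- The cycle lists obtained from `c` by inserting two copies of a new largest value `m`. -/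
def insertions (m : ℕ) (c : List (List ℕ)) : List (List (List ℕ)) :=
  (c ++ [[m, m]]) :: insertInCycle m c

/-- Delete all copies of `m` from the cycles of `c`, dropping cycles that become empty. -/
def eraseValue (m : ℕ) (c : List (List ℕ)) : List (List ℕ) :=
  (c.map (List.filter (fun y => decide (y ≠ m)))).filter (fun w => decide (w ≠ []))

theorem length_insertAfter (m : ℕ) (w : List ℕ) : (insertAfter m w).length = w.length := by
  induction w with
  | nil => rfl
  | cons a w ih => simp [insertAfter, ih]

theorem length_insertInCycle (m : ℕ) (c : List (List ℕ)) :
    (insertInCycle m c).length = c.flatten.length := by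
  induction c with
  | nil => rfl
  | cons w c ih =>
    rw [insertInCycle, List.length_append, List.length_map, List.length_map, ih,
      length_insertAfter, List.flatten_cons, List.length_append]

theorem mem_insertAfter {m : ℕ} {w w' : List ℕ} :
    w' ∈ insertAfter m w ↔ ∃ u v, u ≠ [] ∧ w = u ++ v ∧ w' = u ++ m :: m :: v := by
  induction w generalizing w' with
  | nil => simp [insertAfter]
  | cons a w ih =>
    simp only [insertAfter, List.mem_cons, List.mem_map, ih]
    constructor
    · rintro (rfl | ⟨_, ⟨u, v, hu, rfl, rfl⟩, rfl⟩)
      · exact ⟨[a], w, by simp⟩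
      · exact ⟨a :: u, v, by simp⟩
    · rintro ⟨_ | ⟨b, u⟩, v, hu, h1, rfl⟩
      · exact absurd rfl hu
      · simp only [List.cons_append, List.cons.injEq] at h1
        obtain ⟨rfl, rfl⟩ := h1
        rcases u with _ | ⟨b, u⟩
        · exact Or.inl rfl
        · exact Or.inr ⟨_, ⟨b :: u, v, by simp⟩, rfl⟩

theorem mem_insertInCycle {m : ℕ} {c c' : List (List ℕ)} :
    c' ∈ insertInCycle m c ↔ ∃ c₁ u v c₂, u ≠ [] ∧ c = c₁ ++ (u ++ v) :: c₂ ∧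
      c' = c₁ ++ (u ++ m :: m :: v) :: c₂ := by
  induction c generalizing c' with
  | nil => simp [insertInCycle]
  | cons w c ih =>
    simp only [insertInCycle, List.mem_append, List.mem_map, ih, mem_insertAfter]
    constructor
    · rintro (⟨_, ⟨u, v, hu, rfl, rfl⟩, rfl⟩ | ⟨_, ⟨c₁, u, v, c₂, hu, rfl, rfl⟩, rfl⟩)
      · exact ⟨[], u, v, c, hu, rfl, rfl⟩
      · exact ⟨w :: c₁, u, v, c₂, hu, rfl, rfl⟩
    · rintro ⟨_ | ⟨b, c₁⟩, u, v, c₂, hu, h1, rfl⟩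
      · simp only [List.nil_append, List.cons.injEq] at h1
        obtain ⟨rfl, rfl⟩ := h1
        exact Or.inl ⟨_, ⟨u, v, hu, rfl, rfl⟩, rfl⟩
      · simp only [List.cons_append, List.cons.injEq] at h1
        obtain ⟨rfl, rfl⟩ := h1
        exact Or.inr ⟨_, ⟨c₁, u, v, c₂, hu, rfl, rfl⟩, rfl⟩

theorem length_of_mem_insertInCycle {m : ℕ} {c c' : List (List ℕ)}
    (h : c' ∈ insertInCycle m c) : c'.length = c.length := by
  obtain ⟨c₁, u, v, c₂, -, rfl, rfl⟩ := mem_insertInCycle.1 h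
  simp

theorem nodup_insertAfter {m : ℕ} {w : List ℕ} (h : m ∉ w) : (insertAfter m w).Nodup := by
  induction w with
  | nil => exact List.nodup_nil
  | cons a w ih =>
    rw [insertAfter, List.nodup_cons]
    refine ⟨fun hx => ?_, (ih fun hw => h (by simp [hw])).map (List.cons_injective)⟩
    simp only [List.mem_map, List.cons.injEq, true_and, exists_eq_right, mem_insertAfter] at hx
    obtain ⟨_ | ⟨b, u⟩, v, hu, rfl, hx⟩ := hx
    · exact hu rfl
    · simp only [List.cons_append, List.cons.injEq] at hx
      exact h (by simp [hx.1])

theorem nodup_insertInCycle {m : ℕ} {c : List (List ℕ)} (h : m ∉ c.flatten) :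
    (insertInCycle m c).Nodup := by
  induction c with
  | nil => exact List.nodup_nil
  | cons w c ih =>
    rw [List.flatten_cons, List.mem_append, not_or] at h
    rw [insertInCycle, List.nodup_append']
    refine ⟨(nodup_insertAfter h.1).map fun _ _ e => (List.cons.inj e).1,
      (ih h.2).map List.cons_injective, ?_⟩
    intro x hx hy
    obtain ⟨w', hw', rfl⟩ := List.mem_map.1 hx
    obtain ⟨c', -, e⟩ := List.mem_map.1 hy
    obtain ⟨u, v, -, rfl, rfl⟩ := mem_insertAfter.1 hw'
    have := congrArg List.length (List.cons.inj e).1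
    simp only [List.length_append, List.length_cons] at this
    omega

theorem nodup_insertions {m : ℕ} {c : List (List ℕ)} (h : m ∉ c.flatten) :
    (insertions m c).Nodup := by
  refine List.nodup_cons.2 ⟨fun hx => ?_, nodup_insertInCycle h⟩
  simpa using length_of_mem_insertInCycle hx

theorem eraseValue_of_not_mem {m : ℕ} {c : List (List ℕ)} (h : m ∉ c.flatten)
    (hne : ∀ w ∈ c, w ≠ []) : eraseValue m c = c := by
  have : c.map (List.filter (fun y => decide (y ≠ m))) = c := by
    conv_rhs => rw [← List.map_id c]
    refine List.map_congr_left fun w hw => List.filter_eq_self.2 fun y hy => ?_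
    simpa using fun e : y = m => h (List.mem_flatten.2 ⟨w, hw, e ▸ hy⟩)
  rw [eraseValue, this]
  exact List.filter_eq_self.2 fun w hw => by simpa using hne w hw

theorem eraseValue_of_mem_insertions {m : ℕ} {c c' : List (List ℕ)} (h : m ∉ c.flatten)
    (hne : ∀ w ∈ c, w ≠ []) (hc : c' ∈ insertions m c) : eraseValue m c' = c := by
  rw [← eraseValue_of_not_mem h hne]
  rcases List.mem_cons.1 hc with rfl | hc
  · conv_lhs => rw [eraseValue]
    rw [eraseValue_of_not_mem h hne, List.map_append, List.filter_append]
    conv_rhs => rw [← eraseValue_of_not_mem h hne, eraseValue]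
    simp
  · obtain ⟨c₁, u, v, c₂, -, rfl, rfl⟩ := mem_insertInCycle.1 hc
    rw [eraseValue_of_not_mem h hne]
    conv_rhs => rw [← eraseValue_of_not_mem h hne]
    simp [eraseValue]

theorem IsStirling2.lt_of_mem {n : ℕ} {c : List (List ℕ)} (h : IsStirling2 n c) {x : ℕ}
    (hx : x ∈ c.flatten) : x < n + 1 :=
  Nat.lt_succ_of_le (mem_baseList.1 (h.1.mem_iff.1 hx)).2

theorem IsStirling2.succ_not_mem {n : ℕ} {c : List (List ℕ)} (h : IsStirling2 n c) :
    n + 1 ∉ c.flatten :=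
  fun hx => lt_irrefl _ (h.lt_of_mem hx)

theorem headI_append_of_ne_nil {u : List ℕ} (hu : u ≠ []) (v : List ℕ) :
    (u ++ v).headI = u.headI := by
  cases u <;> simp_all

theorem flatten_insert_perm (m : ℕ) (c₁ c₂ : List (List ℕ)) (u v : List ℕ) :
    (c₁ ++ (u ++ m :: m :: v) :: c₂).flatten.Perm
      (m :: m :: (c₁ ++ (u ++ v) :: c₂).flatten) := by
  rw [List.perm_iff_count]
  intro a
  simp [List.count_cons]
  omega

theorem flatten_append_pair_perm (m : ℕ) (c : List (List ℕ)) :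
    (c ++ [[m, m]]).flatten.Perm (m :: m :: c.flatten) := by
  simpa using List.perm_append_comm (l₁ := c.flatten) (l₂ := [m, m])

theorem IsStirling2.of_mem_insertions {n : ℕ} {c c' : List (List ℕ)} (h : IsStirling2 n c)
    (hc : c' ∈ insertions (n + 1) c) : IsStirling2 (n + 1) c' := by
  have hnot := h.succ_not_mem
  rcases List.mem_cons.1 hc with rfl | hc
  · refine ⟨(flatten_append_pair_perm _ _).trans
      (((h.1.cons _).cons _).trans (baseList_succ_perm n).symm), ?_, ?_⟩
    · intro w hw
      rcases List.mem_append.1 hw with hw | hw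
      · exact h.2.1 w hw
      · obtain rfl := List.mem_singleton.1 hw
        refine ⟨by simp, by simp, by simp, ?_⟩
        simpa using IsStirlingWord.insert_max (u := []) (v := []) (m := n + 1)
          (by intro i; exact i.elim0) (by simp)
    · refine List.isChain_append.2 ⟨h.2.2, by simp, ?_⟩
      intro x hx y hy
      obtain rfl : [n + 1, n + 1] = y := by simpa using hy
      have hxc := List.mem_of_mem_getLast? hx
      rcases x with _ | ⟨b, x⟩
      · exact absurd rfl (h.2.1 _ hxc).1
      · exact h.lt_of_mem (List.mem_flatten.2 ⟨_, hxc, by simp⟩)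
  · obtain ⟨c₁, u, v, c₂, hu, rfl, rfl⟩ := mem_insertInCycle.1 hc
    refine ⟨(flatten_insert_perm _ _ _ _ _).trans
      (((h.1.cons _).cons _).trans (baseList_succ_perm n).symm), ?_, ?_⟩
    · intro w hw
      by_cases hwc : w ∈ c₁ ++ (u ++ v) :: c₂
      · exact h.2.1 w hwc
      · obtain rfl : w = u ++ (n + 1) :: (n + 1) :: v := by
          simp only [List.mem_append, List.mem_cons] at hw hwc
          tauto
        obtain ⟨-, hcount, hhead, hst⟩ := h.2.1 (u ++ v) (by simp)
        have hlt : ∀ x ∈ u ++ v, x < n + 1 := fun x hx =>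
          h.lt_of_mem (List.mem_flatten.2 ⟨_, by simp, hx⟩)
        have hmem : ∀ x ∈ u ++ (n + 1) :: (n + 1) :: v, x = n + 1 ∨ x ∈ u ++ v := by
          intro x hx
          simp only [List.mem_append, List.mem_cons] at hx ⊢
          tauto
        refine ⟨by simp, ?_, ?_, hst.insert_max hlt⟩
        · intro x hx
          rcases hmem x hx with rfl | hx
          · have : (u ++ v).count (n + 1) = 0 :=
              List.count_eq_zero.2 fun h => lt_irrefl _ (hlt _ h)
            simp only [List.count_append, List.count_cons_self] at this ⊢
            omega
          · have h1 := hcount x hx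
            have h2 := (hlt x hx).ne'
            simpa [List.count_cons, h2] using h1
        · intro x hx
          rw [headI_append_of_ne_nil hu] at hhead ⊢
          rcases hmem x hx with rfl | hx
          · rcases u with _ | ⟨b, u⟩
            · exact absurd rfl hu
            · exact (hlt b (by simp)).le
          · exact hhead x hx
    · have := h.2.2
      unfold List.Chain' at this ⊢
      rw [← List.isChain_map (R := (· < ·)) List.headI] at this ⊢
      simpa [headI_append_of_ne_nil hu] using this

theorem IsStirling2.exists_mem_insertions {n : ℕ} {c' : List (List ℕ)}
    (h : IsStirling2 (n + 1) c') : ∃ c, IsStirling2 n c ∧ c' ∈ insertions (n + 1) c := by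
  have hle : ∀ w ∈ c', ∀ x ∈ w, x ≤ n + 1 := fun w hw x hx =>
    (mem_baseList.1 (h.1.mem_iff.1 (List.mem_flatten.2 ⟨w, hw, hx⟩))).2
  obtain ⟨w, hw, hmw⟩ : ∃ w ∈ c', n + 1 ∈ w :=
    List.mem_flatten.1 (h.1.mem_iff.2 (mem_baseList.2 ⟨by omega, le_rfl⟩))
  obtain ⟨c₁, c₂, rfl⟩ := List.append_of_mem hw
  obtain ⟨u, v, rfl, hmu⟩ := List.eq_append_cons_of_mem hmw
  obtain ⟨-, hcount, hhead, hst⟩ := h.2.1 _ hw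
  have hc := hcount _ hmw
  rw [List.count_append, List.count_cons_self, List.count_eq_zero.2 hmu] at hc
  obtain ⟨x, z, rfl⟩ : ∃ x z, v = x ++ (n + 1) :: z :=
    List.append_of_mem (List.count_pos_iff.1 (by omega))
  obtain rfl : x = [] := by
    refine List.eq_nil_iff_forall_not_mem.2 fun y hy => ?_
    refine absurd (hle _ hw y (by simp [hy])) (not_le.2 ?_)
    refine (isStirlingWord_iff_sublist _).1 hst _ _ (.trans ?_ (List.sublist_append_right _ _))
    refine List.Sublist.cons_cons _ ?_
    exact List.Sublist.append (List.singleton_sublist.2 hy)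
      (List.Sublist.cons_cons _ (List.nil_sublist z))
  rw [List.nil_append] at *
  have hmz : n + 1 ∉ z := List.count_eq_zero.1 (by rw [List.count_cons_self] at hc; omega)
  by_cases hu : u = []
  · subst hu
    obtain rfl : z = [] := by
      refine List.eq_nil_iff_forall_not_mem.2 fun y hy => hmz ?_
      have h1 := hhead y (by simp [hy])
      have h2 := hle _ hw y (by simp [hy])
      simp only [List.nil_append, List.headI_cons] at h1
      rwa [← le_antisymm h2 h1]
    obtain rfl : c₂ = [] := by
      rcases c₂ with _ | ⟨w, c₂⟩
      · rfl
      · exfalso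
        have h1 := (List.isChain_cons_cons.1 (List.isChain_append.1 h.2.2).2.1).1
        have hwc : w ∈ c₁ ++ ([] ++ [n + 1, n + 1]) :: w :: c₂ := by simp
        rcases w with _ | ⟨b, w⟩
        · exact (h.2.1 _ hwc).1 rfl
        · have := hle _ hwc b (by simp)
          simp only [List.nil_append, List.headI_cons] at h1
          omega
    refine ⟨c₁, ⟨?_, fun w hw => h.2.1 w (by simp [hw]), (List.isChain_append.1 h.2.2).1⟩,
      List.mem_cons_self⟩
    exact ((flatten_append_pair_perm _ _).symm.trans
      (h.1.trans (baseList_succ_perm n))).cons_inv.cons_inv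
  · refine ⟨c₁ ++ (u ++ z) :: c₂, ⟨?_, ?_, ?_⟩,
      List.mem_cons_of_mem _ (mem_insertInCycle.2 ⟨c₁, u, z, c₂, hu, rfl, rfl⟩)⟩
    · exact ((flatten_insert_perm _ _ _ _ _).symm.trans
        (h.1.trans (baseList_succ_perm n))).cons_inv.cons_inv
    · intro w hw'
      by_cases hwc : w = u ++ z
      · subst hwc
        have hsub : List.Sublist (u ++ z) (u ++ (n + 1) :: (n + 1) :: z) :=
          (List.Sublist.refl u).append (((List.Sublist.refl z).cons _).cons _)
        refine ⟨by simp [hu], fun x hx => ?_, fun x hx => ?_, hst.sublist hsub⟩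
        · have h1 := hcount x (hsub.subset hx)
          have h2 : n + 1 ≠ x := by
            rintro rfl
            exact (List.mem_append.1 hx).elim hmu hmz
          simpa [List.count_cons, h2] using h1
        · have := hhead x (hsub.subset hx)
          rwa [headI_append_of_ne_nil hu] at this ⊢
      · refine h.2.1 w ?_
        simp only [List.mem_append, List.mem_cons] at hw' ⊢
        tauto
    · have := h.2.2
      unfold List.Chain' at this ⊢
      rw [← List.isChain_map (R := (· < ·)) List.headI] at this ⊢
      simpa [headI_append_of_ne_nil hu] using this

theorem stirling2_succ (n : ℕ) :
    stirling2 (n + 1) = (stirling2 n).biUnion fun c => (insertions (n + 1) c).toFinset := by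
  ext c'
  simp only [Finset.mem_biUnion, List.mem_toFinset, mem_stirling2]
  exact ⟨fun h => h.exists_mem_insertions, fun ⟨_, hc, hc'⟩ => hc.of_mem_insertions hc'⟩

theorem sum_insertions {R : Type*} [CommSemiring R] (q : R) {n : ℕ} {c : List (List ℕ)}
    (h : IsStirling2 n c) :
    ∑ c' ∈ (insertions (n + 1) c).toFinset, q ^ cyc c' = q ^ cyc c * (q + (2 * n : ℕ)) := by
  have h1 : (insertInCycle (n + 1) c).map (fun c' => q ^ cyc c') =
      List.replicate (2 * n) (q ^ cyc c) := by
    refine List.eq_replicate_iff.2 ⟨?_, fun x hx => ?_⟩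
    · rw [List.length_map, length_insertInCycle, h.1.length_eq, length_baseList]
    · obtain ⟨c', hc', rfl⟩ := List.mem_map.1 hx
      rw [cyc, cyc, length_of_mem_insertInCycle hc']
  rw [List.sum_toFinset _ (nodup_insertions h.succ_not_mem), insertions, List.map_cons,
    List.sum_cons, h1, List.sum_replicate, nsmul_eq_mul]
  simp only [cyc, List.length_append, List.length_singleton, pow_succ]
  ring

/-- For `n ≥ 1`:  `∑_{σ ∈ Q_n²} q^{cyc(σ)} = q(q+2)(q+4)⋯(q+2n-2)`. -/
theorem stmt7 (n : ℕ) (hn : 1 ≤ n) :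
    ∑ σ ∈ stirling2 n, (Polynomial.X : Polynomial ℚ) ^ cyc σ =
      ∏ j ∈ Finset.range n, (Polynomial.X + (2 * j : ℕ) • (1 : Polynomial ℚ)) := by
  clear hn
  induction n with
  | zero => simp [stirling2_zero, cyc]
  | succ n ih =>
    rw [stirling2_succ, Finset.sum_biUnion, Finset.prod_range_succ, ← ih, Finset.sum_mul]
    · refine Finset.sum_congr rfl fun c hc => ?_
      rw [sum_insertions _ (mem_stirling2.1 hc), nsmul_one]
    · intro c hc d hd hne
      rw [Finset.mem_coe, mem_stirling2] at hc hd
      refine Finset.disjoint_left.2 fun x hx hy => hne ?_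
      rw [List.mem_toFinset] at hx hy
      rw [← eraseValue_of_mem_insertions hc.succ_not_mem (fun w hw => (hc.2.1 w hw).1) hx,
        eraseValue_of_mem_insertions hd.succ_not_mem (fun w hw => (hd.2.1 w hw).1) hy]
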